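/- If f is a uniformly random Boolean function on F_2^n, then E[Δ(f)] / √(2^n · log 2^n) → 2 as n → ∞. -/

import Mathlib

open Finset Filter

def ac {n : ℕ} (f : (Fin n → ZMod 2) → ZMod 2) (u : Fin n → ZMod 2) : ℤ :=
  ∑ x : Fin n → ZMod 2, (-1 : ℤ) ^ ((f x + f (x + u)).val)

def absInd {n : ℕ} (f : (Fin n → ZMod 2) → ZMod 2) : ℕ :=
  Finset.sup (Finset.univ.erase 0) fun u => (ac f u).natAbs

noncomputable def ev (n : ℕ) (X : ((Fin n → ZMod 2) → ZMod 2) → ℝ) : ℝ :=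
  (∑ f : (Fin n → ZMod 2) → ZMod 2, X f) / Fintype.card ((Fin n → ZMod 2) → ZMod 2)


/-- The real-valued sign `(-1)^a` of a bit. -/
def bitSign (a : ZMod 2) : ℝ := (-1) ^ a.val

lemma bitSign_zero : bitSign 0 = 1 := pow_zero _

lemma bitSign_one : bitSign 1 = -1 := pow_one _

lemma zmod_two_eq_zero_or_one : ∀ a : ZMod 2, a = 0 ∨ a = 1 := by decide

lemma bitSign_add (a b : ZMod 2) : bitSign (a + b) = bitSign a * bitSign b := by
  have h : (1 : ZMod 2) + 1 = 0 := by decide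
  rcases zmod_two_eq_zero_or_one a with rfl | rfl <;>
    rcases zmod_two_eq_zero_or_one b with rfl | rfl <;> simp [bitSign_zero, bitSign_one, h]

lemma bitSign_eq_one_or (a : ZMod 2) : bitSign a = 1 ∨ bitSign a = -1 := by
  rcases zmod_two_eq_zero_or_one a with rfl | rfl <;> simp [bitSign_zero, bitSign_one]

lemma bitSign_mul_self (a : ZMod 2) : bitSign a * bitSign a = 1 := by
  rcases bitSign_eq_one_or a with h | h <;> simp [h]

lemma cosh_mul_bitSign (r : ℝ) (a : ZMod 2) : Real.cosh (r * bitSign a) = Real.cosh r := by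
  rcases bitSign_eq_one_or a with h | h <;> simp [h]

lemma add_add_self_zmod_two {n : ℕ} (x w : Fin n → ZMod 2) : x + w + w = x := by
  ext i
  simp [add_assoc, CharTwo.add_self_eq_zero]

/-- Integrating out independent uniform signs indexed by `P`, when the coefficients do not
depend on them. -/
lemma sum_mul_exp_sum_bitSign {α : Type*} [Fintype α] [DecidableEq α] (P : Finset α)
    (φ : (α → ZMod 2) → ℝ) (a : (α → ZMod 2) → α → ℝ)
    (hφ : ∀ x ∈ P, ∀ f, φ (f + Pi.single x 1) = φ f)
    (ha : ∀ x ∈ P, ∀ y ∈ P, ∀ f, a (f + Pi.single x 1) y = a f y) :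
    ∑ f, φ f * Real.exp (∑ x ∈ P, a f x * bitSign (f x)) =
      ∑ f, φ f * ∏ x ∈ P, Real.cosh (a f x) := by
  induction P using Finset.induction_on generalizing φ with
  | empty => simp
  | insert x P hx ih =>
    have ha' : ∀ z ∈ P, ∀ y ∈ P, ∀ f, a (f + Pi.single z 1) y = a f y := fun z hz y hy =>
      ha z (mem_insert_of_mem hz) y (mem_insert_of_mem hy)
    have h1 := ih (fun f => φ f * Real.exp (a f x * bitSign (f x))) (by
      intro z hz f
      have hzx : x ≠ z := fun h => hx (h ▸ hz)
      simp [hφ z (mem_insert_of_mem hz), ha z (mem_insert_of_mem hz) x (mem_insert_self _ _),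
        Pi.single_eq_of_ne hzx]) ha'
    simp only [sum_insert hx, prod_insert hx, Real.exp_add]
    simp only [mul_assoc] at h1
    rw [h1]
    set ψ : (α → ZMod 2) → ℝ := fun f =>
      φ f * (Real.exp (a f x * bitSign (f x)) * ∏ y ∈ P, Real.cosh (a f y)) with hψ
    have h2 : ∑ f, ψ f = ∑ f : α → ZMod 2, ψ (f + Pi.single x 1) :=
      (Equiv.sum_comp (Equiv.addRight (Pi.single x (1 : ZMod 2) : α → ZMod 2)) ψ).symm
    have h3 : ∀ f, ψ f + ψ (f + Pi.single x 1) =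
        2 * (φ f * (Real.cosh (a f x) * ∏ y ∈ P, Real.cosh (a f y))) := by
      intro f
      have hp : ∏ y ∈ P, Real.cosh (a (f + Pi.single x 1) y) = ∏ y ∈ P, Real.cosh (a f y) :=
        prod_congr rfl fun y hy => by
          rw [ha x (mem_insert_self _ _) y (mem_insert_of_mem hy)]
      simp only [hψ]
      rw [hp, hφ x (mem_insert_self _ _), ha x (mem_insert_self _ _) x (mem_insert_self _ _)]
      simp only [Pi.add_apply, Pi.single_eq_same, bitSign_add, bitSign_one]
      rw [Real.cosh_eq]
      rcases bitSign_eq_one_or (f x) with h | h <;> simp [h] <;> ring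
    have h4 : 2 * ∑ f, ψ f =
        2 * ∑ f, φ f * (Real.cosh (a f x) * ∏ y ∈ P, Real.cosh (a f y)) := by
      rw [two_mul]
      nth_rewrite 2 [h2]
      rw [← sum_add_distrib, mul_sum]
      exact sum_congr rfl fun f _ => h3 f
    linarith

lemma sum_eq_two_mul_sum_filter {n : ℕ} (T : Finset (Fin n → ZMod 2)) (w : Fin n → ZMod 2)
    (j : Fin n) (hw : w j = 1) (hT : ∀ x ∈ T, x + w ∈ T) (g : (Fin n → ZMod 2) → ℝ)
    (hg : ∀ x, g (x + w) = g x) :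
    ∑ x ∈ T, g x = 2 * ∑ x ∈ T with x j = 0, g x := by
  rw [← sum_filter_add_sum_filter_not T (fun x => x j = 0), two_mul]
  congr 1
  have h01 : ∀ a : ZMod 2, ¬ a = 0 → a + 1 = 0 := by decide
  refine sum_nbij' (· + w) (· + w) ?_ ?_ ?_ ?_ ?_
  · intro x hx
    simp only [mem_filter] at hx ⊢
    exact ⟨hT x hx.1, by simpa [hw] using h01 _ hx.2⟩
  · intro x hx
    simp only [mem_filter] at hx ⊢
    exact ⟨hT x hx.1, by simp [hw, hx.2]⟩
  · intro x _; exact add_add_self_zmod_two x w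
  · intro x _; exact add_add_self_zmod_two x w
  · intro x _; exact (hg x).symm

lemma two_mul_card_filter_eq_zero {n : ℕ} (i : Fin n) :
    2 * ((univ.filter fun x : Fin n → ZMod 2 => x i = 0).card : ℝ) = 2 ^ n := by
  have h := sum_eq_two_mul_sum_filter univ (Pi.single i 1) i (by simp) (by simp)
    (fun _ => (1 : ℝ)) (by simp)
  simp at h
  exact h.symm

lemma two_mul_card_filter_eq_one {n : ℕ} (i : Fin n) :
    2 * ((univ.filter fun x : Fin n → ZMod 2 => x i = 1).card : ℝ) = 2 ^ n := by
  have h := Finset.card_filter_add_card_filter_not (s := (univ : Finset (Fin n → ZMod 2)))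
    (fun x => x i = 0)
  have h01 : ∀ a : ZMod 2, ¬ a = 0 ↔ a = 1 := by decide
  simp only [h01] at h
  have h' := congrArg (Nat.cast (R := ℝ)) h
  simp at h'
  have := two_mul_card_filter_eq_zero i
  linarith

lemma ac_cast {n : ℕ} (f : (Fin n → ZMod 2) → ZMod 2) (u : Fin n → ZMod 2) :
    (ac f u : ℝ) = ∑ x, bitSign (f x) * bitSign (f (x + u)) := by
  simp only [ac, Int.cast_sum, ← bitSign_add]
  simp [bitSign]

lemma ac_cast_eq_half {n : ℕ} (f : (Fin n → ZMod 2) → ZMod 2) (u : Fin n → ZMod 2) (i : Fin n)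
    (hu : u i = 1) :
    (ac f u : ℝ) = 2 * ∑ x with x i = 0, bitSign (f (x + u)) * bitSign (f x) := by
  rw [ac_cast, sum_eq_two_mul_sum_filter univ u i hu (by simp)]
  · simp only [mul_comm]
  · intro x
    rw [add_add_self_zmod_two, mul_comm]

section ev

variable {n : ℕ} {X Y : ((Fin n → ZMod 2) → ZMod 2) → ℝ}

lemma ev_mono (h : ∀ f, X f ≤ Y f) : ev n X ≤ ev n Y := by
  unfold ev
  gcongr
  exact h _

lemma ev_const (c : ℝ) : ev n (fun _ => c) = c := by
  unfold ev
  rw [sum_const, card_univ, nsmul_eq_mul]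
  field_simp

lemma ev_add : ev n (fun f => X f + Y f) = ev n X + ev n Y := by
  simp [ev, sum_add_distrib, add_div]

lemma ev_sub : ev n (fun f => X f - Y f) = ev n X - ev n Y := by
  simp [ev, sub_div]

lemma ev_const_mul (c : ℝ) : ev n (fun f => c * X f) = c * ev n X := by
  simp [ev, ← mul_sum, mul_div_assoc]

lemma ev_sum {ι : Type*} (s : Finset ι) (Z : ι → ((Fin n → ZMod 2) → ZMod 2) → ℝ) :
    ev n (fun f => ∑ i ∈ s, Z i f) = ∑ i ∈ s, ev n (Z i) := by
  simp only [ev]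
  rw [sum_comm, sum_div]

end ev

lemma ev_exp_sum_bitSign {n : ℕ} (P : Finset (Fin n → ZMod 2))
    (a : ((Fin n → ZMod 2) → ZMod 2) → (Fin n → ZMod 2) → ℝ)
    (ha : ∀ x ∈ P, ∀ y ∈ P, ∀ f, a (f + Pi.single x 1) y = a f y) :
    ev n (fun f => Real.exp (∑ x ∈ P, a f x * bitSign (f x))) =
      ev n (fun f => ∏ x ∈ P, Real.cosh (a f x)) := by
  have h := sum_mul_exp_sum_bitSign P (fun _ => 1) a (by simp) ha
  simp only [one_mul] at h
  simp only [ev, h]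

/-- Products `f(x) f(x+w)` of signs over a set disjoint from its `w`-translate are independent. -/
lemma ev_exp_mul_sum_bitSign {n : ℕ} (P : Finset (Fin n → ZMod 2)) (w : Fin n → ZMod 2)
    (hP : ∀ x ∈ P, x + w ∉ P) (r : ℝ) :
    ev n (fun f => Real.exp (r * ∑ x ∈ P, bitSign (f (x + w)) * bitSign (f x))) =
      Real.cosh r ^ P.card := by
  have h := ev_exp_sum_bitSign P (fun f x => r * bitSign (f (x + w))) (by
    intro x hx y hy f
    have : y + w ≠ x := fun h => hP y hy (h ▸ hx)
    simp [Pi.single_eq_of_ne this])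
  simp only [cosh_mul_bitSign, prod_const, ev_const] at h
  rw [← h]
  simp only [mul_sum, mul_assoc]

/-- The moment generating function of one autocorrelation. -/
lemma ev_exp_ac {n : ℕ} (u : Fin n → ZMod 2) (i : Fin n) (hu : u i = 1) (t : ℝ) :
    ev n (fun f => Real.exp (t * ac f u)) =
      Real.cosh (2 * t) ^ (univ.filter fun x : Fin n → ZMod 2 => x i = 0).card := by
  rw [← ev_exp_mul_sum_bitSign _ u]
  · congr! 3 with f
    rw [ac_cast_eq_half f u i hu]
    ring
  · intro x hx
    simp only [mem_filter, mem_univ, true_and] at hx ⊢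
    simp [hx, hu]

lemma cosh_pow_le (r : ℝ) (k : ℕ) : Real.cosh r ^ k ≤ Real.exp (r ^ 2 / 2 * k) := by
  rw [mul_comm, Real.exp_nat_mul]
  exact pow_le_pow_left₀ (Real.cosh_pos _).le (Real.cosh_le_exp_half_sq r) k

lemma ev_exp_ac_le {n : ℕ} (u : Fin n → ZMod 2) (hu : u ≠ 0) (t : ℝ) :
    ev n (fun f => Real.exp (t * ac f u)) ≤ Real.exp (t ^ 2 * 2 ^ n) := by
  obtain ⟨i, hi⟩ := Function.ne_iff.1 hu
  have h01 : ∀ a : ZMod 2, a ≠ 0 → a = 1 := by decide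
  rw [ev_exp_ac u i (h01 _ hi)]
  refine (cosh_pow_le _ _).trans (Real.exp_le_exp.2 ?_)
  rw [← two_mul_card_filter_eq_zero i]
  apply le_of_eq
  ring

/-- The joint moment generating function of two autocorrelations. -/
lemma ev_exp_ac_add_ac_le {n : ℕ} (u v : Fin n → ZMod 2) (i : Fin n) (hu : u i = 1) (hv : v i = 1)
    (huv : u ≠ v) (t : ℝ) :
    ev n (fun f => Real.exp (t * (ac f u + ac f v))) ≤
      Real.exp (2 * t ^ 2 * 2 ^ n + 32 * t ^ 4 * 2 ^ n) := by
  set P : Finset (Fin n → ZMod 2) := univ.filter fun x => x i = 0 with hPdef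
  set Q : Finset (Fin n → ZMod 2) := univ.filter fun x => x i = 1 with hQdef
  have hP : ∀ x ∈ P, x i = 0 := fun x hx => by simpa [hPdef] using hx
  have h1 : ev n (fun f => Real.exp (t * (ac f u + ac f v))) =
      ev n (fun f => ∏ x ∈ P,
        Real.cosh (2 * t * (bitSign (f (x + u)) + bitSign (f (x + v))))) := by
    rw [← ev_exp_sum_bitSign]
    · congr! 3 with f
      rw [ac_cast_eq_half f u i hu, ac_cast_eq_half f v i hv, ← mul_add, ← sum_add_distrib,
        ← mul_assoc, mul_sum]
      exact sum_congr rfl fun x _ => by ring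
    · intro x hx y hy f
      have h1 : y + u ≠ x := fun h => by
        have := congrFun h i
        simp [hP x hx, hP y hy, hu] at this
      have h2 : y + v ≠ x := fun h => by
        have := congrFun h i
        simp [hP x hx, hP y hy, hv] at this
      simp [Pi.single_eq_of_ne h1, Pi.single_eq_of_ne h2]
  obtain ⟨j, hj⟩ := Function.ne_iff.1 huv
  set w := u + v with hw
  have hwi : w i = 0 := by simp [hw, hu, hv]; decide
  have hwj : w j = 1 := by
    have : ∀ a b : ZMod 2, a ≠ b → a + b = 1 := by decide
    exact this _ _ hj
  have h2 : ∀ f : (Fin n → ZMod 2) → ZMod 2,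
      ∑ x ∈ P, bitSign (f (x + u)) * bitSign (f (x + v)) =
        2 * ∑ z ∈ Q with z j = 0, bitSign (f (z + w)) * bitSign (f z) := by
    intro f
    rw [← sum_eq_two_mul_sum_filter Q w j hwj]
    · have h11 : (1 : ZMod 2) + 1 = 0 := by decide
      refine sum_nbij' (· + u) (· + u) ?_ ?_ ?_ ?_ ?_
      · intro x hx
        simp [hQdef, hP x hx, hu]
      · intro x hx
        simp only [hQdef, mem_filter, mem_univ, true_and] at hx
        simp [hPdef, hx, hu, h11]
      · intro x _; exact add_add_self_zmod_two x u
      · intro x _; exact add_add_self_zmod_two x u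
      · intro x _
        rw [hw, ← add_assoc, add_add_self_zmod_two, mul_comm]
    · intro x hx
      simp only [hQdef, mem_filter, mem_univ, true_and] at hx ⊢
      simp [hx, hwi]
    · intro x
      rw [add_add_self_zmod_two, mul_comm]
  have h3 : ∀ f : (Fin n → ZMod 2) → ZMod 2,
      ∏ x ∈ P, Real.cosh (2 * t * (bitSign (f (x + u)) + bitSign (f (x + v)))) ≤
        Real.exp (2 * t ^ 2 * 2 ^ n) *
          Real.exp (8 * t ^ 2 * ∑ z ∈ Q with z j = 0, bitSign (f (z + w)) * bitSign (f z)) := by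
    intro f
    calc _ ≤ ∏ x ∈ P, Real.exp
          (4 * t ^ 2 + 4 * t ^ 2 * (bitSign (f (x + u)) * bitSign (f (x + v)))) := by
          refine prod_le_prod (fun x _ => (Real.cosh_pos _).le) fun x _ => ?_
          refine (Real.cosh_le_exp_half_sq _).trans (Real.exp_le_exp.2 (le_of_eq ?_))
          linear_combination (2 * t ^ 2) * bitSign_mul_self (f (x + u)) +
            (2 * t ^ 2) * bitSign_mul_self (f (x + v))
      _ = _ := by
          rw [← Real.exp_sum, ← Real.exp_add, sum_add_distrib, ← mul_sum _ _ (4 * t ^ 2), h2, sum_const,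
            nsmul_eq_mul, ← two_mul_card_filter_eq_zero i]
          congr 1
          ring
  rw [h1]
  refine (ev_mono h3).trans ?_
  rw [ev_const_mul, ev_exp_mul_sum_bitSign, Real.exp_add]
  · refine mul_le_mul_of_nonneg_left ((cosh_pow_le _ _).trans (Real.exp_le_exp.2 ?_))
      (Real.exp_pos _).le
    have hc : ((Q.filter fun z => z j = 0).card : ℝ) ≤ 2 ^ n := by
      have := card_le_univ (Q.filter fun z => z j = 0)
      simp at this
      exact_mod_cast this
    calc _ = 32 * t ^ 4 * ((Q.filter fun z => z j = 0).card : ℝ) := by ring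
      _ ≤ _ := by gcongr
  · intro x hx
    simp only [mem_filter] at hx ⊢
    simp [hx.2, hwj]

lemma ac_le_absInd {n : ℕ} (f : (Fin n → ZMod 2) → ZMod 2) {u : Fin n → ZMod 2} (hu : u ≠ 0) :
    (ac f u : ℝ) ≤ absInd f := by
  have h : (ac f u).natAbs ≤ absInd f :=
    le_sup (f := fun u => (ac f u).natAbs) (mem_erase.2 ⟨hu, mem_univ u⟩)
  have h' : ac f u ≤ absInd f := by omega
  exact_mod_cast h'

lemma exp_mul_absInd_le {n : ℕ} (hn : n ≠ 0) (t : ℝ) (f : (Fin n → ZMod 2) → ZMod 2) :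
    Real.exp (t * absInd f) ≤
      ∑ u ∈ univ.erase 0, (Real.exp (t * ac f u) + Real.exp (-t * ac f u)) := by
  have : NeZero n := ⟨hn⟩
  have hne : (univ.erase (0 : Fin n → ZMod 2)).Nonempty := by
    refine ⟨fun _ => 1, mem_erase.2 ⟨fun h => ?_, mem_univ _⟩⟩
    exact one_ne_zero (congrFun h 0)
  obtain ⟨u, hu, h⟩ := exists_mem_eq_sup _ hne fun u => (ac f u).natAbs
  have hmax : Real.exp (t * absInd f) ≤ Real.exp (t * ac f u) + Real.exp (-t * ac f u) := by
    rw [absInd, h, Nat.cast_natAbs, Int.cast_abs]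
    rcases abs_choice (ac f u : ℝ) with h | h <;> rw [h]
    · exact le_add_of_nonneg_right (Real.exp_pos _).le
    · rw [mul_neg, ← neg_mul]
      exact le_add_of_nonneg_left (Real.exp_pos _).le
  exact hmax.trans (single_le_sum
    (f := fun u => Real.exp (t * ac f u) + Real.exp (-t * ac f u)) (fun v _ => by positivity) hu)

lemma mul_ev_absInd_le {n : ℕ} (hn : n ≠ 0) (t : ℝ) :
    t * ev n (fun f => (absInd f : ℝ)) ≤ Real.log (2 * 2 ^ n) + t ^ 2 * 2 ^ n := by
  set b : ℝ := Real.log (2 * 2 ^ n) + t ^ 2 * 2 ^ n with hb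
  have hexp : Real.exp b = 2 ^ n * (2 * Real.exp (t ^ 2 * 2 ^ n)) := by
    rw [hb, Real.exp_add, Real.exp_log (by positivity)]
    ring
  have h1 : ev n (fun f => Real.exp (t * absInd f)) ≤ Real.exp b := by
    refine (ev_mono (exp_mul_absInd_le hn t)).trans ?_
    rw [ev_sum, hexp]
    calc _ ≤ ∑ _u ∈ univ.erase (0 : Fin n → ZMod 2), 2 * Real.exp (t ^ 2 * 2 ^ n) := by
          refine sum_le_sum fun u hu => ?_
          rw [ev_add]
          have h1 := ev_exp_ac_le u (mem_erase.1 hu).1 t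
          have h2 := ev_exp_ac_le u (mem_erase.1 hu).1 (-t)
          rw [neg_sq] at h2
          linarith
      _ ≤ ∑ _u : Fin n → ZMod 2, 2 * Real.exp (t ^ 2 * 2 ^ n) :=
          sum_le_sum_of_subset_of_nonneg (erase_subset _ _) fun _ _ _ => by positivity
      _ = _ := by simp
  have h2 : ev n (fun f => t * absInd f + (1 - b)) ≤
      ev n (fun f => Real.exp (-b) * Real.exp (t * absInd f)) := by
    refine ev_mono fun f => ?_
    rw [← Real.exp_add]
    linarith [Real.add_one_le_exp (-b + t * absInd f)]
  rw [ev_add, ev_const, ev_const_mul, ev_const_mul] at h2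
  have h3 : Real.exp (-b) * ev n (fun f => Real.exp (t * absInd f)) ≤ 1 := by
    calc _ ≤ Real.exp (-b) * Real.exp b := by gcongr
      _ = 1 := by rw [← Real.exp_add]; simp
  linarith

/-- The second moment method. -/
lemma ev_sq_le_ev_indicator_mul {n : ℕ} (S : ((Fin n → ZMod 2) → ZMod 2) → ℝ) :
    ev n S ^ 2 ≤ ev n (fun f => if S f = 0 then 0 else 1) * ev n (fun f => S f ^ 2) := by
  have h := sum_mul_sq_le_sq_mul_sq univ (fun f => if S f = 0 then (0 : ℝ) else 1) S
  simp only [ite_mul, zero_mul, one_mul, ite_pow, one_pow, zero_pow two_ne_zero] at h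
  have h' : ∀ f, (if S f = 0 then 0 else S f) = S f := fun f => by
    split_ifs with h0 <;> simp [h0]
  simp only [h'] at h
  simp only [ev, div_pow, div_mul_div_comm, ← sq]
  gcongr

lemma exp_le_cosh (x : ℝ) : Real.exp (x ^ 2 / 2 - x ^ 4 / 4) ≤ Real.cosh x := by
  have h1 : 1 + x ^ 2 / 2 ≤ Real.cosh x := by
    have h := Real.cosh_two_mul (x / 2)
    rw [Real.cosh_sq, mul_div_cancel₀ x two_ne_zero] at h
    have h2 : (x / 2) ^ 2 ≤ Real.sinh (x / 2) ^ 2 := by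
      rw [sq_le_sq, Real.abs_sinh]
      exact Real.self_le_sinh_iff.2 (abs_nonneg _)
    linarith
  refine le_trans ?_ h1
  have hpos : 0 < 1 + x ^ 2 / 2 := by positivity
  rw [← Real.le_log_iff_exp_le hpos]
  refine le_trans ?_ (Real.one_sub_inv_le_log_of_pos hpos)
  rw [← sub_nonneg]
  have : 1 - (1 + x ^ 2 / 2)⁻¹ - (x ^ 2 / 2 - x ^ 4 / 4) =
      (x ^ 6 / 8) / (1 + x ^ 2 / 2) := by
    field_simp
    ring
  rw [this]
  positivity

lemma le_ev_exp_ac {n : ℕ} (u : Fin n → ZMod 2) (i : Fin n) (hu : u i = 1) (t : ℝ) :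
    Real.exp (t ^ 2 * 2 ^ n - 2 * t ^ 4 * 2 ^ n) ≤ ev n (fun f => Real.exp (t * ac f u)) := by
  rw [ev_exp_ac u i hu, ← two_mul_card_filter_eq_zero i]
  refine le_trans (le_of_eq ?_) (pow_le_pow_left₀ (Real.exp_pos _).le (exp_le_cosh (2 * t)) _)
  rw [← Real.exp_nat_mul]
  congr 1
  ring

/-- The exponential `exp (t * a)` restricted to a window of `a`. -/
noncomputable def windowExp (t l l' a : ℝ) : ℝ := if l ≤ a ∧ a ≤ l' then Real.exp (t * a) else 0

lemma windowExp_nonneg (t l l' a : ℝ) : 0 ≤ windowExp t l l' a := by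
  unfold windowExp
  split_ifs <;> positivity

lemma windowExp_le (t l l' a : ℝ) : windowExp t l l' a ≤ Real.exp (t * a) := by
  unfold windowExp
  split_ifs
  · rfl
  · positivity

lemma windowExp_sq_le {t : ℝ} (ht : 0 ≤ t) (l l' a : ℝ) :
    windowExp t l l' a * windowExp t l l' a ≤ Real.exp (t * l') * Real.exp (t * a) := by
  unfold windowExp
  split_ifs with h
  · gcongr
    exact h.2
  · rw [zero_mul]
    positivity

lemma le_windowExp {r : ℝ} (hr : 0 ≤ r) (t l l' a : ℝ) :
    Real.exp (t * a) - Real.exp (r * l) * Real.exp ((t - r) * a)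
      - Real.exp (-r * l') * Real.exp ((t + r) * a) ≤ windowExp t l l' a := by
  unfold windowExp
  simp only [← Real.exp_add]
  have p1 := Real.exp_pos (r * l + (t - r) * a)
  have p2 := Real.exp_pos (-r * l' + (t + r) * a)
  split_ifs with h
  · linarith
  · rw [not_and_or, not_le, not_le] at h
    rcases h with h | h
    · have : Real.exp (t * a) ≤ Real.exp (r * l + (t - r) * a) := Real.exp_le_exp.2 (by
        nlinarith [mul_le_mul_of_nonneg_left h.le hr])
      linarith
    · have : Real.exp (t * a) ≤ Real.exp (-r * l' + (t + r) * a) := Real.exp_le_exp.2 (by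
        nlinarith [mul_le_mul_of_nonneg_left h.le hr])
      linarith

lemma le_ev_windowExp_ac {n : ℕ} (u : Fin n → ZMod 2) (i : Fin n) (hu : u i = 1) {t η : ℝ}
    (ht : 0 ≤ t) (hη : 0 ≤ η) :
    Real.exp (t ^ 2 * 2 ^ n) *
        (Real.exp (-(2 * t ^ 4 * 2 ^ n)) - 2 * Real.exp (-(η ^ 2 * t ^ 2 * 2 ^ n))) ≤
      ev n (fun f => windowExp t ((1 - η) * (2 * t * 2 ^ n)) ((1 + η) * (2 * t * 2 ^ n))
        (ac f u)) := by
  have hu0 : u ≠ 0 := fun h => by simp [h] at hu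
  refine le_trans ?_ (ev_mono fun f => le_windowExp (mul_nonneg hη ht) t _ _ _)
  rw [ev_sub, ev_sub, ev_const_mul, ev_const_mul]
  have h0 := le_ev_exp_ac u i hu t
  have h1 : Real.exp (η * t * ((1 - η) * (2 * t * 2 ^ n))) *
      ev n (fun f => Real.exp ((t - η * t) * ac f u)) ≤
        Real.exp (t ^ 2 * 2 ^ n + -(η ^ 2 * t ^ 2 * 2 ^ n)) := by
    refine (mul_le_mul_of_nonneg_left (ev_exp_ac_le u hu0 _) (Real.exp_pos _).le).trans
      (le_of_eq ?_)
    rw [← Real.exp_add]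
    congr 1
    ring
  have h2 : Real.exp (-(η * t) * ((1 + η) * (2 * t * 2 ^ n))) *
      ev n (fun f => Real.exp ((t + η * t) * ac f u)) ≤
        Real.exp (t ^ 2 * 2 ^ n + -(η ^ 2 * t ^ 2 * 2 ^ n)) := by
    refine (mul_le_mul_of_nonneg_left (ev_exp_ac_le u hu0 _) (Real.exp_pos _).le).trans
      (le_of_eq ?_)
    rw [← Real.exp_add]
    congr 1
    ring
  rw [sub_eq_add_neg, Real.exp_add] at h0
  rw [Real.exp_add] at h1 h2
  linarith

lemma ev_sum_windowExp_sq_le {n : ℕ} (i : Fin n) {t : ℝ} (ht : 0 ≤ t) (l l' : ℝ) :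
    ev n (fun f => (∑ u with u i = 1, windowExp t l l' (ac f u)) ^ 2) ≤
      2 ^ n / 2 * Real.exp (t * l' + t ^ 2 * 2 ^ n) +
        (2 ^ n / 2) ^ 2 * Real.exp (2 * t ^ 2 * 2 ^ n + 32 * t ^ 4 * 2 ^ n) := by
  set U : Finset (Fin n → ZMod 2) := univ.filter fun u => u i = 1 with hU
  have hcard : (U.card : ℝ) = 2 ^ n / 2 := by
    rw [← two_mul_card_filter_eq_one i]
    ring
  have hU1 : ∀ u ∈ U, u i = 1 := fun u hu => by simpa [hU] using hu
  simp only [sq (∑ u ∈ U, _), sum_mul_sum, ev_sum]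
  calc _ ≤ ∑ u ∈ U, ∑ v ∈ U, ((if u = v then Real.exp (t * l' + t ^ 2 * 2 ^ n) else 0) +
          Real.exp (2 * t ^ 2 * 2 ^ n + 32 * t ^ 4 * 2 ^ n)) := by
        refine sum_le_sum fun u hu => sum_le_sum fun v hv => ?_
        split_ifs with huv
        · subst huv
          have hu0 : u ≠ 0 := fun h => by simpa [h] using hU1 u hu
          refine le_trans ?_ (le_add_of_nonneg_right (Real.exp_pos _).le)
          refine (ev_mono fun f => windowExp_sq_le ht l l' _).trans ?_
          rw [ev_const_mul, Real.exp_add]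
          gcongr
          exact ev_exp_ac_le u hu0 t
        · rw [zero_add]
          refine le_trans (ev_mono fun f => ?_)
            (ev_exp_ac_add_ac_le u v i (hU1 u hu) (hU1 v hv) huv t)
          rw [mul_add, Real.exp_add]
          exact mul_le_mul (windowExp_le _ _ _ _) (windowExp_le _ _ _ _)
            (windowExp_nonneg _ _ _ _) (Real.exp_pos _).le
    _ = _ := by
        simp only [sum_add_distrib, sum_ite_eq, sum_const, nsmul_eq_mul]
        rw [sum_congr rfl fun u hu => if_pos hu, sum_const, nsmul_eq_mul, hcard]
        ring

lemma le_ev_absInd_mul {n : ℕ} (i : Fin n) {t η : ℝ} (ht : 0 ≤ t) (hη : 0 ≤ η) (hη1 : η ≤ 1)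
    (hE : 2 * Real.exp (-(η ^ 2 * t ^ 2 * 2 ^ n)) ≤ Real.exp (-(2 * t ^ 4 * 2 ^ n))) :
    (1 - η) * (2 * t * 2 ^ n) *
        (Real.exp (-(2 * t ^ 4 * 2 ^ n)) - 2 * Real.exp (-(η ^ 2 * t ^ 2 * 2 ^ n))) ^ 2 ≤
      ev n (fun f => (absInd f : ℝ)) *
        (2 * Real.exp ((1 + 2 * η) * (t ^ 2 * 2 ^ n)) / 2 ^ n +
          Real.exp (32 * t ^ 4 * 2 ^ n)) := by
  set l : ℝ := (1 - η) * (2 * t * 2 ^ n) with hl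
  set l' : ℝ := (1 + η) * (2 * t * 2 ^ n) with hl'
  set e : ℝ := Real.exp (-(2 * t ^ 4 * 2 ^ n)) - 2 * Real.exp (-(η ^ 2 * t ^ 2 * 2 ^ n)) with he
  set K : ℝ := Real.exp (t ^ 2 * 2 ^ n) with hK
  set S : ((Fin n → ZMod 2) → ZMod 2) → ℝ :=
    fun f => ∑ u with u i = 1, windowExp t l l' (ac f u) with hS
  have hKpos : 0 < K := Real.exp_pos _
  have he0 : 0 ≤ e := sub_nonneg.2 hE
  have hl0 : 0 ≤ l := mul_nonneg (sub_nonneg.2 hη1) (by positivity)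
  have h1 : 2 ^ n / 2 * (K * e) ≤ ev n S := by
    rw [hS, ev_sum, ← two_mul_card_filter_eq_one i, mul_div_cancel_left₀ _ two_ne_zero,
      ← nsmul_eq_mul]
    refine card_nsmul_le_sum _ _ _ fun u hu => ?_
    exact le_ev_windowExp_ac u i (mem_filter.1 hu).2 ht hη
  have h2 : ev n (fun f => S f ^ 2) ≤ (2 ^ n / 2 * K) ^ 2 *
      (2 * Real.exp ((1 + 2 * η) * (t ^ 2 * 2 ^ n)) / 2 ^ n + Real.exp (32 * t ^ 4 * 2 ^ n)) := by
    refine (ev_sum_windowExp_sq_le i ht l l').trans (le_of_eq ?_)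
    have e1 : Real.exp (t * l' + t ^ 2 * 2 ^ n) =
        K ^ 2 * Real.exp ((1 + 2 * η) * (t ^ 2 * 2 ^ n)) := by
      rw [hK, ← Real.exp_nat_mul, ← Real.exp_add]
      congr 1
      rw [hl']
      push_cast
      ring
    have e2 : Real.exp (2 * t ^ 2 * 2 ^ n + 32 * t ^ 4 * 2 ^ n) =
        K ^ 2 * Real.exp (32 * t ^ 4 * 2 ^ n) := by
      rw [hK, ← Real.exp_nat_mul, ← Real.exp_add]
      congr 1
      push_cast
      ring
    rw [e1, e2]
    field_simp
  set p : ℝ := ev n (fun f => if S f = 0 then 0 else 1) with hp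
  have hp0 : 0 ≤ p := by
    rw [← ev_const (n := n) 0]
    exact ev_mono fun f => by split_ifs <;> simp
  have h3 : l * p ≤ ev n (fun f => (absInd f : ℝ)) := by
    rw [hp, ← ev_const_mul]
    refine ev_mono fun f => ?_
    split_ifs with h0
    · simp
    · obtain ⟨u, hu, hu'⟩ := exists_ne_zero_of_sum_ne_zero h0
      have hu0 : u ≠ 0 := fun h => by simp [h] at hu
      have hw : l ≤ ac f u := by
        by_contra hlt
        exact hu' (if_neg fun h => hlt h.1)
      rw [mul_one]
      exact hw.trans (ac_le_absInd f hu0)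
  set D : ℝ :=
    2 * Real.exp ((1 + 2 * η) * (t ^ 2 * 2 ^ n)) / 2 ^ n + Real.exp (32 * t ^ 4 * 2 ^ n) with hD
  have hD0 : 0 ≤ D := by positivity
  have h4 : (2 ^ n / 2 * K) ^ 2 * e ^ 2 ≤ (2 ^ n / 2 * K) ^ 2 * (p * D) := by
    calc _ = (2 ^ n / 2 * (K * e)) ^ 2 := by ring
      _ ≤ ev n S ^ 2 := by gcongr
      _ ≤ p * ev n (fun f => S f ^ 2) := ev_sq_le_ev_indicator_mul S
      _ ≤ p * ((2 ^ n / 2 * K) ^ 2 * D) := by gcongr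
      _ = _ := by ring
  have h5 : e ^ 2 ≤ p * D := le_of_mul_le_mul_left h4 (by positivity)
  calc l * e ^ 2 ≤ l * (p * D) := by gcongr
    _ = l * p * D := by ring
    _ ≤ _ := by gcongr

/-- The upper bound, optimised over the parameter of the moment generating function. -/
lemma ev_absInd_div_le {n : ℕ} (hn : n ≠ 0) :
    ev n (fun f => (absInd f : ℝ)) / Real.sqrt (2 ^ n * Real.log (2 ^ n)) ≤
      2 + Real.log 2 / Real.log (2 ^ n) := by
  have hN : (0 : ℝ) < 2 ^ n := by positivity
  have hL : 0 < Real.log (2 ^ n) := Real.log_pos (one_lt_pow₀ one_lt_two hn)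
  have h := mul_ev_absInd_le hn (Real.sqrt (Real.log (2 ^ n) / 2 ^ n))
  rw [Real.sq_sqrt (by positivity), div_mul_cancel₀ _ hN.ne',
    Real.log_mul two_ne_zero hN.ne'] at h
  have hs : Real.sqrt (Real.log (2 ^ n) / 2 ^ n) * Real.sqrt (2 ^ n * Real.log (2 ^ n)) =
      Real.log (2 ^ n) := by
    rw [← Real.sqrt_mul (by positivity), ← Real.sqrt_sq hL.le]
    congr 1
    rw [Real.sqrt_sq hL.le]
    field_simp
  have hs0 : 0 < Real.sqrt (Real.log (2 ^ n) / 2 ^ n) := by positivity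
  rw [div_le_iff₀ (by positivity)]
  refine le_of_mul_le_mul_left (h.trans (le_of_eq ?_)) hs0
  rw [mul_left_comm, hs]
  field_simp
  ring

lemma le_ev_absInd_div {n : ℕ} (hn : n ≠ 0) {c η : ℝ} (hc : 0 ≤ c) (hη : 0 ≤ η) (hη1 : η ≤ 1)
    (hE : 2 * Real.exp (-(η ^ 2 * c ^ 2 * Real.log (2 ^ n))) ≤
      Real.exp (-(2 * c ^ 4 * (Real.log (2 ^ n) ^ 2 / 2 ^ n)))) :
    2 * (1 - η) * c * (Real.exp (-(2 * c ^ 4 * (Real.log (2 ^ n) ^ 2 / 2 ^ n))) -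
        2 * Real.exp (-(η ^ 2 * c ^ 2 * Real.log (2 ^ n)))) ^ 2 /
      (2 * Real.exp (((1 + 2 * η) * c ^ 2 - 1) * Real.log (2 ^ n)) +
        Real.exp (32 * c ^ 4 * (Real.log (2 ^ n) ^ 2 / 2 ^ n))) ≤
      ev n (fun f => (absInd f : ℝ)) / Real.sqrt (2 ^ n * Real.log (2 ^ n)) := by
  have hN : (0 : ℝ) < 2 ^ n := by positivity
  have hL : 0 < Real.log (2 ^ n) := Real.log_pos (one_lt_pow₀ one_lt_two hn)
  set N : ℝ := 2 ^ n with hNdef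
  set L : ℝ := Real.log N with hLdef
  set t : ℝ := c * Real.sqrt (L / N) with ht
  have ht2 : t ^ 2 * N = c ^ 2 * L := by
    rw [ht, mul_pow, Real.sq_sqrt (by positivity)]
    field_simp
  have ht4 : t ^ 4 * N = c ^ 4 * (L ^ 2 / N) := by
    have : t ^ 4 * N = (t ^ 2 * N) ^ 2 / N := by
      field_simp
    rw [this, ht2]
    ring
  have htN : t * N = c * Real.sqrt (N * L) := by
    rw [ht, mul_assoc]
    congr 1
    rw [show L / N = N * L / N ^ 2 by field_simp, Real.sqrt_div (by positivity),
      Real.sqrt_sq hN.le]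
    field_simp
  have a1 : 2 * t ^ 4 * N = 2 * c ^ 4 * (L ^ 2 / N) := by rw [mul_assoc, ht4]; ring
  have a2 : 32 * t ^ 4 * N = 32 * c ^ 4 * (L ^ 2 / N) := by rw [mul_assoc, ht4]; ring
  have a3 : η ^ 2 * t ^ 2 * N = η ^ 2 * c ^ 2 * L := by rw [mul_assoc, ht2]; ring
  have a4 : 2 * Real.exp ((1 + 2 * η) * (t ^ 2 * N)) / N =
      2 * Real.exp (((1 + 2 * η) * c ^ 2 - 1) * L) := by
    rw [ht2, sub_mul, one_mul, Real.exp_sub, hLdef, Real.exp_log hN, mul_assoc (1 + 2 * η),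
      mul_div_assoc]
  have h := le_ev_absInd_mul (n := n) ⟨0, Nat.pos_of_ne_zero hn⟩ (t := t) (η := η)
    (by positivity) hη hη1 (by rw [← hNdef, a1, a3]; exact hE)
  rw [← hNdef, a1, a2, a3, a4, mul_assoc 2 t N, htN] at h
  rw [div_le_div_iff₀ (by positivity) (by positivity)]
  refine le_trans (le_of_eq ?_) h
  ring

lemma tendsto_log_sq_div_two_pow :
    Tendsto (fun n : ℕ => Real.log (2 ^ n) ^ 2 / 2 ^ n) atTop (nhds 0) :=
  (Real.isLittleO_pow_log_id_atTop (n := 2)).tendsto_div_nhds_zero.comp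
    (tendsto_pow_atTop_atTop_of_one_lt one_lt_two)

lemma tendsto_log_two_pow : Tendsto (fun n : ℕ => Real.log (2 ^ n)) atTop atTop :=
  Real.tendsto_log_atTop.comp (tendsto_pow_atTop_atTop_of_one_lt one_lt_two)

lemma eventually_lt_ev_absInd_div {a η : ℝ} (hη : 0 < η) (hη1 : η < 1)
    (ha : a < 2 * (1 - η) ^ 2) :
    ∀ᶠ n : ℕ in atTop,
      a < ev n (fun f => (absInd f : ℝ)) / Real.sqrt (2 ^ n * Real.log (2 ^ n)) := by
  have hc : 0 < 1 - η := sub_pos.2 hη1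
  have hsmall (b : ℝ) : Tendsto (fun n : ℕ => Real.exp (b * (Real.log (2 ^ n) ^ 2 / 2 ^ n)))
      atTop (nhds 1) := by
    have := (tendsto_log_sq_div_two_pow.const_mul b).rexp
    simpa using this
  have hbig {b : ℝ} (hb : b < 0) : Tendsto (fun n : ℕ => Real.exp (b * Real.log (2 ^ n)))
      atTop (nhds 0) :=
    Real.tendsto_exp_atBot.comp (tendsto_log_two_pow.const_mul_atTop_of_neg hb)
  have h1 := hsmall (-(2 * (1 - η) ^ 4))
  have h2 := (hbig (b := -(η ^ 2 * (1 - η) ^ 2)) (neg_neg_of_pos (by positivity))).const_mul 2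
  have h3 := (hbig (b := (1 + 2 * η) * (1 - η) ^ 2 - 1)
    (by nlinarith [mul_pos (mul_pos hη hη) hc, mul_pos hη hη])).const_mul 2
  have h4 := hsmall (32 * (1 - η) ^ 4)
  have hlim := (((h1.sub h2).pow 2).const_mul (2 * (1 - η) * (1 - η))).div (h3.add h4) (by simp)
  have hE := h2.eventually_lt h1 (by simp)
  simp only [neg_mul] at hlim hE
  have hlim' := hlim.eventually_const_lt (u := a) (by
    norm_num
    linarith)
  filter_upwards [hlim', hE, eventually_ne_atTop 0] with n hn1 hn2 hn3
  exact hn1.trans_le (le_ev_absInd_div hn3 hc.le hη.le hη1.le hn2.le)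

theorem stmt14 :
    Tendsto
      (fun n => ev n (fun f => (absInd f : ℝ)) / Real.sqrt (2 ^ n * Real.log (2 ^ n)))
      atTop (nhds 2) := by
  refine tendsto_order.2 ⟨fun a ha => ?_, fun a ha => ?_⟩
  · have hcont : Tendsto (fun η : ℝ => 2 * (1 - η) ^ 2) (nhdsWithin 0 (Set.Ioi 0)) (nhds 2) := by
      have : Continuous fun η : ℝ => 2 * (1 - η) ^ 2 := by fun_prop
      simpa using (this.tendsto 0).mono_left nhdsWithin_le_nhds
    obtain ⟨η, h1, h2⟩ := ((hcont.eventually_const_lt ha).and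
      (Ioo_mem_nhdsGT (zero_lt_one (α := ℝ)))).exists
    exact eventually_lt_ev_absInd_div h2.1 h2.2 h1
  · have hlim : Tendsto (fun n : ℕ => 2 + Real.log 2 / Real.log (2 ^ n)) atTop (nhds 2) := by
      simpa using (tendsto_log_two_pow.const_div_atTop (Real.log 2)).const_add 2
    filter_upwards [hlim.eventually_lt_const ha, eventually_ne_atTop 0] with n hn1 hn2
    exact (ev_absInd_div_le hn2).trans_lt hn1
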